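/- arXiv:2511.05069 — 2 statements merged into one kernel-verified Lean document; each statement's English description precedes it below -/
import Mathlib

section
/- Let (X, 𝓑) be a standard Borel space, T : X → X a Borel bijection with Borel inverse, φ : X → ℝ Borel, and μ a φ-conformal Borel probability measure for T. Let A ∈ 𝓑 satisfy ⋃_{n≥0} T⁻ⁿA = ⋃_{n≥0} TⁿA = X and 0 < μ(A) < 1; let r_A(x) = min{ n ≥ 1 : Tⁿx ∈ A } (assumed finite for every x ∈ A), T_A(x) = T^{r_A(x)}(x) the first-return map of A, φ_A(x) = S_{r_A(x)}φ(x), and μ_A(B) = μ(B ∩ A)/μ(A) the conditional measure on A; and let R : A → X be a Borel bijection with Borel inverse satisfying T∘R = R∘T_A. Suppose either (i) μ is the unique φ-conformal Borel probability measure for T, or (ii) μ_A and R⁻¹_*μ are equivalent and μ is ergodic for T. Then: if φ∘R = φ_A, then μ_A = R⁻¹_*μ; conversely, if μ_A = R⁻¹_*μ, then φ∘R = φ_A holds μ_A-almost everywhere. -/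
open MeasureTheory
open scoped ENNReal

namespace MeasureTheory

variable {α X Y : Type*} [MeasurableSpace X] [MeasurableSpace Y]

/-- The change-of-variables formula for the pushforward of a measure with density `g ∘ f`. -/
theorem map_withDensity_comp {ν : Measure X} {f : X → Y} {g : Y → ℝ≥0∞}
    (hf : Measurable f) (hg : Measurable g) :
    (ν.withDensity (g ∘ f)).map f = (ν.map f).withDensity g := by
  ext s hs
  rw [Measure.map_apply hf hs, withDensity_apply _ (hf hs), withDensity_apply _ hs,
    setLIntegral_map hs hg hf]
  rfl

/-- The density `e^φ`. -/
noncomputable def expDensity (φ : α → ℝ) (x : α) : ℝ≥0∞ := ENNReal.ofReal (Real.exp (φ x))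

theorem measurable_expDensity {φ : X → ℝ} (hφ : Measurable φ) : Measurable (expDensity φ) :=
  (Real.measurable_exp.comp hφ).ennreal_ofReal

theorem expDensity_ne_zero (φ : α → ℝ) (x : α) : expDensity φ x ≠ 0 := by
  simp [expDensity, Real.exp_pos]

theorem expDensity_ne_top (φ : α → ℝ) (x : α) : expDensity φ x ≠ ∞ := ENNReal.ofReal_ne_top

theorem expDensity_inj {φ ψ : α → ℝ} {x : α} (h : expDensity φ x = expDensity ψ x) :
    φ x = ψ x := by
  rwa [expDensity, expDensity, ENNReal.ofReal_eq_ofReal_iff (Real.exp_pos _).le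
    (Real.exp_pos _).le, Real.exp_eq_exp] at h

/-- Conformality of `ν` in terms of the pushforward under the inverse `S` of `T`, restated in terms
of the pushforward under `T`. -/
theorem map_eq_withDensity_iff {T S : X → X} (hT : Measurable T) (hS : Measurable S)
    (hl : Function.LeftInverse S T) (hr : Function.RightInverse S T)
    {ν : Measure X} {g : X → ℝ≥0∞} :
    ν.map S = ν.withDensity g ↔ (ν.withDensity g).map T = ν := by
  constructor
  · intro h
    rw [← h, Measure.map_map hT hS, hr.comp_eq_id, Measure.map_id]
  · intro h
    conv_lhs => rw [← h]
    rw [Measure.map_map hS hT, hl.comp_eq_id, Measure.map_id]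

theorem measurable_birkhoffSum {T : X → X} (hT : Measurable T) {φ : X → ℝ} (hφ : Measurable φ)
    (n : ℕ) : Measurable (birkhoffSum T φ n) := by
  unfold birkhoffSum
  exact Finset.measurable_sum _ fun i _ => hφ.comp (hT.iterate i)

theorem measurable_birkhoffSum_time {T : X → X} (hT : Measurable T) {φ : X → ℝ}
    (hφ : Measurable φ) {r : X → ℕ} (hr : Measurable r) :
    Measurable fun x => birkhoffSum T φ (r x) x := by
  have h : Measurable fun p : ℕ × X => birkhoffSum T φ p.1 p.2 :=
    measurable_from_prod_countable_right fun n => measurable_birkhoffSum hT hφ n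
  exact h.comp (hr.prodMk measurable_id)

/-- A conformal measure for `T` is conformal for its iterates, with respect to Birkhoff sums. -/
theorem map_iterate_withDensity_birkhoffSum {T : X → X} (hT : Measurable T) {φ : X → ℝ}
    (hφ : Measurable φ) {μ : Measure X} (h : (μ.withDensity (expDensity φ)).map T = μ) (n : ℕ) :
    (μ.withDensity (expDensity (birkhoffSum T φ n))).map T^[n] = μ := by
  induction n with
  | zero =>
    have : expDensity (birkhoffSum T φ 0) = 1 := by
      ext x
      simp [expDensity]
    rw [this, withDensity_one, Function.iterate_zero, Measure.map_id]
  | succ n ih =>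
    have hS := measurable_expDensity (measurable_birkhoffSum hT hφ n)
    have : expDensity (birkhoffSum T φ (n + 1))
        = expDensity φ * expDensity (birkhoffSum T φ n) ∘ T := by
      ext x
      simp only [expDensity, Pi.mul_apply, Function.comp_apply, birkhoffSum_succ']
      rw [Real.exp_add, ENNReal.ofReal_mul (Real.exp_pos _).le]
    rw [this, withDensity_mul _ (measurable_expDensity hφ) (hS.comp hT),
      Function.iterate_succ, ← Measure.map_map (hT.iterate n) hT, map_withDensity_comp hT hS, h, ih]

/-- If `G` is a bijection of `A` given by `x ↦ T^[r x] x`, then a `φ`-conformal measure for `T`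
restricts to a conformal measure for `G` on `A`, with respect to Birkhoff sums of length `r`. -/
theorem map_withDensity_birkhoffSum_time {T S : X → X} (hT : Measurable T) (hS : Measurable S)
    (hl : Function.LeftInverse S T) (hr : Function.RightInverse S T) {φ : X → ℝ}
    (hφ : Measurable φ) {μ : Measure X} (h : (μ.withDensity (expDensity φ)).map T = μ)
    {A : Set X} (hA : MeasurableSet A) {r : X → ℕ} (hrm : Measurable r)
    {G : X → X} (hG : Measurable G) (hGr : ∀ x ∈ A, G x = T^[r x] x) (hbij : Set.BijOn G A A) :
    ((μ.restrict A).withDensity (expDensity fun x => birkhoffSum T φ (r x) x)).map G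
      = μ.restrict A := by
  ext B hB
  let E : ℕ → Set X := fun n => A ∩ G ⁻¹' B ∩ r ⁻¹' {n}
  have hE : ∀ n, MeasurableSet (E n) := fun n =>
    (hA.inter (hG hB)).inter (hrm (measurableSet_singleton n))
  have hEd : Pairwise (Function.onFun Disjoint E) := by
    intro m n hmn
    refine Set.disjoint_left.2 fun x hx hy => hmn ?_
    exact (hx.2 : r x = m).symm.trans (hy.2 : r x = n)
  have hEU : ⋃ n, E n = A ∩ G ⁻¹' B := by
    ext x
    simp [E]
  have himg : ∀ n, G '' E n = S^[n] ⁻¹' E n := by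
    intro n
    rw [← Set.image_eq_preimage_of_inverse (hl.iterate n) (hr.iterate n)]
    refine Set.image_congr fun x hx => ?_
    rw [hGr x hx.1.1, (hx.2 : r x = n)]
  have hterm : ∀ n, ∫⁻ x in E n, expDensity (fun x => birkhoffSum T φ (r x) x) x ∂μ
      = μ (G '' E n) := by
    intro n
    have h1 : ∫⁻ x in E n, expDensity (fun x => birkhoffSum T φ (r x) x) x ∂μ
        = ∫⁻ x in E n, expDensity (birkhoffSum T φ n) x ∂μ := by
      refine setLIntegral_congr_fun (hE n) fun x hx => ?_
      simp only [expDensity]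
      rw [(hx.2 : r x = n)]
    have hpre : T^[n] ⁻¹' (S^[n] ⁻¹' E n) = E n := by
      rw [← Set.preimage_comp, (hl.iterate n).comp_eq_id, Set.preimage_id]
    rw [h1, himg]
    conv_rhs => rw [← map_iterate_withDensity_birkhoffSum hT hφ h n]
    rw [Measure.map_apply (hT.iterate n) ((hS.iterate n) (hE n)), hpre, withDensity_apply _ (hE n)]
  have hGU : ⋃ n, G '' E n = B ∩ A := by
    rw [← Set.image_iUnion, hEU, Set.image_inter_preimage, hbij.image_eq, Set.inter_comm]
  have hGd : Pairwise (Function.onFun Disjoint fun n => G '' E n) := by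
    intro m n hmn
    exact (hEd hmn).image hbij.injOn (fun x hx => hx.1.1) fun x hx => hx.1.1
  rw [Measure.map_apply hG hB, withDensity_apply _ (hG hB), Measure.restrict_restrict (hG hB),
    Set.inter_comm, ← hEU, lintegral_iUnion hE hEd, Measure.restrict_apply hB, ← hGU,
    measure_iUnion hGd fun n => by rw [himg]; exact (hS.iterate n) (hE n)]
  exact tsum_congr hterm

/-- For an ergodic conformal probability measure `μ`, every conformal probability measure
absolutely continuous with respect to `μ` equals `μ`. -/
theorem eq_of_absolutelyContinuous_of_conformal {T S : X → X} (hT : Measurable T)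
    (hS : Measurable S) (hl : Function.LeftInverse S T)
    {φ : X → ℝ} (hφ : Measurable φ) {μ ν : Measure X} [IsProbabilityMeasure μ]
    [IsProbabilityMeasure ν] (hμ : (μ.withDensity (expDensity φ)).map T = μ)
    (hν : (ν.withDensity (expDensity φ)).map T = ν) (hac : ν ≪ μ) (herg : PreErgodic T μ) :
    ν = μ := by
  have he := measurable_expDensity hφ
  have hh : Measurable (ν.rnDeriv μ) := Measure.measurable_rnDeriv ν μ
  have hd : μ.withDensity (ν.rnDeriv μ) = ν := Measure.withDensity_rnDeriv_eq ν μ hac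
  have hq : QuasiErgodic T μ := by
    refine ⟨⟨hT, ?_⟩, herg⟩
    have h1 := (withDensity_absolutelyContinuous' (μ := μ) he.aemeasurable
      (.of_forall (expDensity_ne_zero φ))).map hT
    rwa [hμ] at h1
  have h2 : μ.withDensity (expDensity φ * ν.rnDeriv μ ∘ T)
      = μ.withDensity (expDensity φ * ν.rnDeriv μ) := by
    have hL : (μ.withDensity (expDensity φ * ν.rnDeriv μ ∘ T)).map T = ν := by
      rw [withDensity_mul _ he (hh.comp hT), map_withDensity_comp hT hh, hμ, hd]
    have hR : (μ.withDensity (expDensity φ * ν.rnDeriv μ)).map T = ν := by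
      rw [mul_comm, withDensity_mul _ hh he, hd, hν]
    have h3 := congrArg (Measure.map S) (hL.trans hR.symm)
    rwa [Measure.map_map hS hT, Measure.map_map hS hT, hl.comp_eq_id, Measure.map_id,
      Measure.map_id] at h3
  rw [withDensity_eq_iff_of_sigmaFinite (he.mul (hh.comp hT)).aemeasurable
    (he.mul hh).aemeasurable] at h2
  have hinv : ν.rnDeriv μ ∘ T =ᵐ[μ] ν.rnDeriv μ := by
    filter_upwards [h2] with x hx
    exact (ENNReal.mul_right_inj (expDensity_ne_zero φ x) (expDensity_ne_top φ x)).1 hx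
  obtain ⟨c, hc⟩ := hq.ae_eq_const_of_ae_eq_comp₀ hh.nullMeasurable hinv
  have hcν : c • μ = ν := by
    rw [← withDensity_const, ← hd]
    exact (withDensity_congr_ae hc).symm
  have hc1 : c = 1 := by
    simpa using congrArg (fun m : Measure X => m Set.univ) hcν
  rw [← hcν, hc1, one_smul]

theorem preErgodic_of_symmDiff {T : X → X} {μ : Measure X} [IsProbabilityMeasure μ]
    (h : ∀ B : Set X, MeasurableSet B → μ (symmDiff B (T ⁻¹' B)) = 0 → μ B = 0 ∨ μ B = 1) :
    PreErgodic T μ := by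
  refine ⟨fun s hs hTs => ?_⟩
  rw [Filter.eventuallyConst_set']
  refine (h s hs (by simp [hTs])).imp (fun h0 => ae_eq_empty.2 h0) fun h1 => ?_
  rw [ae_eq_univ]
  exact (prob_compl_eq_zero_iff hs).2 h1

/-- The first-return time to `A`, extended by zero outside `A`, is measurable. -/
theorem measurable_indicator_returnTime {T : X → X} (hT : Measurable T) {A : Set X}
    (hA : MeasurableSet A) {r : X → ℕ} (hr1 : ∀ x ∈ A, 1 ≤ r x) (hr2 : ∀ x ∈ A, T^[r x] x ∈ A)
    (hr3 : ∀ x ∈ A, ∀ k, 1 ≤ k → k < r x → T^[k] x ∉ A) : Measurable (A.indicator r) := by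
  classical
  have hpre : ∀ k, MeasurableSet (T^[k] ⁻¹' A) := fun k => (hT.iterate k) hA
  refine measurable_to_countable' fun n => ?_
  rcases Nat.eq_zero_or_pos n with rfl | hn
  · have : A.indicator r ⁻¹' {0} = Aᶜ := by
      ext x
      by_cases hx : x ∈ A
      · have := hr1 x hx
        simp [hx]
        omega
      · simp [hx]
    rw [this]
    exact hA.compl
  · have : A.indicator r ⁻¹' {n}
        = A ∩ (T^[n] ⁻¹' A ∩ ⋂ k, ⋂ (_ : 1 ≤ k ∧ k < n), (T^[k] ⁻¹' A)ᶜ) := by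
      ext x
      by_cases hx : x ∈ A
      · simp only [Set.mem_preimage, Set.indicator_of_mem hx, Set.mem_singleton_iff,
          Set.mem_inter_iff, hx, true_and, Set.mem_iInter, Set.mem_compl_iff]
        constructor
        · rintro rfl
          exact ⟨hr2 x hx, fun k hk => hr3 x hx k hk.1 hk.2⟩
        · rintro ⟨h1, h2⟩
          refine le_antisymm (not_lt.1 fun hlt => hr3 x hx n hn hlt h1) (not_lt.1 fun hlt => ?_)
          exact h2 _ ⟨hr1 x hx, hlt⟩ (hr2 x hx)
      · simp [hx, hn.ne]
    rw [this]
    exact hA.inter ((hpre n).inter (.iInter fun k => .iInter fun _ => (hpre k).compl))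

end MeasureTheory

/-- Renormalization of conformal measures: with `μ` a `φ`-conformal probability
measure, `A` a sweeping-out set, `T_A` the first-return map and `R : A → X` a rescaling
with `T ∘ R = R ∘ T_A`, if `μ` is the unique `φ`-conformal measure, or if the
conditional measure `μ_A` is equivalent to `R⁻¹_* μ` and `μ` is ergodic, then:
`φ ∘ R = φ_A` implies `μ_A = R⁻¹_* μ`; and conversely `μ_A = R⁻¹_* μ` implies
`φ ∘ R = φ_A` holds `μ_A`-almost everywhere. -/
theorem conformal_renormalized_measure
    {X : Type*} [MeasurableSpace X] [StandardBorelSpace X]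
    (T Tinv : X → X) (hTm : Measurable T) (hTim : Measurable Tinv)
    (hTl : Function.LeftInverse Tinv T) (hTr : Function.RightInverse Tinv T)
    (φ : X → ℝ) (hφ : Measurable φ)
    (μ : Measure X) [IsProbabilityMeasure μ]
    (hconf : μ.map Tinv = μ.withDensity fun x => ENNReal.ofReal (Real.exp (φ x)))
    (A : Set X) (hA : MeasurableSet A)
    (hcov1 : (⋃ n : ℕ, (T^[n]) ⁻¹' A) = Set.univ)
    (hcov2 : (⋃ n : ℕ, (T^[n]) '' A) = Set.univ)
    (hApos : 0 < μ A) (hAlt : μ A < 1)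
    (rA : X → ℕ)
    (hr1 : ∀ x ∈ A, 1 ≤ rA x) (hr2 : ∀ x ∈ A, T^[rA x] x ∈ A)
    (hr3 : ∀ x ∈ A, ∀ k, 1 ≤ k → k < rA x → T^[k] x ∉ A)
    (R Rinv : X → X) (hRm : Measurable R) (hRim : Measurable Rinv)
    (hRiA : ∀ y, Rinv y ∈ A) (hRRi : ∀ y, R (Rinv y) = y)
    (hRiR : ∀ x ∈ A, Rinv (R x) = x)
    (hTR : ∀ x ∈ A, T (R x) = R (T^[rA x] x))
    (hyp :
      (∀ ν : Measure X, IsProbabilityMeasure ν →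
          ν.map Tinv = ν.withDensity (fun x => ENNReal.ofReal (Real.exp (φ x))) → ν = μ)
      ∨ ((((μ A)⁻¹ • μ.restrict A) ≪ μ.map Rinv ∧ μ.map Rinv ≪ ((μ A)⁻¹ • μ.restrict A))
          ∧ (∀ B : Set X, MeasurableSet B →
              μ (symmDiff B (T ⁻¹' B)) = 0 → μ B = 0 ∨ μ B = 1))) :
    ((∀ x ∈ A, φ (R x) = ∑ i ∈ Finset.range (rA x), φ (T^[i] x)) →
        (μ A)⁻¹ • μ.restrict A = μ.map Rinv) ∧
    ((μ A)⁻¹ • μ.restrict A = μ.map Rinv →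
        ∀ᵐ x ∂((μ A)⁻¹ • μ.restrict A),
          φ (R x) = ∑ i ∈ Finset.range (rA x), φ (T^[i] x)) := by
  have hTμ : (μ.withDensity (expDensity φ)).map T = μ :=
    (map_eq_withDensity_iff hTm hTim hTl hTr).1 hconf
  set μA : Measure X := (μ A)⁻¹ • μ.restrict A with hμA
  have hprob : IsProbabilityMeasure μA := by
    refine ⟨?_⟩
    rw [hμA, Measure.smul_apply, Measure.restrict_apply_univ, smul_eq_mul,
      ENNReal.inv_mul_cancel hApos.ne' (measure_ne_top μ A)]
  have hmemA : ∀ᵐ x ∂μA, x ∈ A := Measure.ae_smul_measure (ae_restrict_mem hA) _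
  set r : X → ℕ := A.indicator rA
  have hrm : Measurable r := measurable_indicator_returnTime hTm hA hr1 hr2 hr3
  have hrA : ∀ x ∈ A, r x = rA x := fun x hx => Set.indicator_of_mem hx _
  set G : X → X := fun x => Rinv (T (R x)) with hGdef
  have hGm : Measurable G := hRim.comp (hTm.comp hRm)
  have hGr : ∀ x ∈ A, G x = T^[r x] x := by
    intro x hx
    simp only [hGdef]
    rw [hTR x hx, hRiR _ (hr2 x hx), hrA x hx]
  have hGbij : Set.BijOn G A A := by
    refine ⟨fun x _ => hRiA _, fun x hx y hy hxy => ?_, fun y hy => ?_⟩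
    · have h1 : T (R x) = T (R y) := by
        rw [← hRRi (T (R x)), ← hRRi (T (R y))]
        exact congrArg R hxy
      rw [← hRiR x hx, ← hRiR y hy, hTl.injective h1]
    · refine ⟨Rinv (Tinv (R y)), hRiA _, ?_⟩
      simp only [hGdef]
      rw [hRRi, hTr, hRiR y hy]
  have hSm : Measurable fun x => birkhoffSum T φ (r x) x := measurable_birkhoffSum_time hTm hφ hrm
  have hret : (μA.withDensity (expDensity fun x => birkhoffSum T φ (r x) x)).map G = μA := by
    rw [hμA, withDensity_smul_measure, Measure.map_smul,
      map_withDensity_birkhoffSum_time hTm hTim hTl hTr hφ hTμ hA hrm hGm hGr hGbij]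
  have hRG : R ∘ G = T ∘ R := by
    ext x
    exact hRRi _
  have hpush : (μA.withDensity (expDensity fun x => birkhoffSum T φ (r x) x)).map (T ∘ R)
      = μA.map R := by
    rw [← hRG, ← Measure.map_map hRm hGm, hret]
  have hRback : (μA.map R).map Rinv = μA := by
    rw [Measure.map_map hRim hRm]
    have : Rinv ∘ R =ᵐ[μA] id := by
      filter_upwards [hmemA] with x hx using hRiR x hx
    rw [Measure.map_congr this, Measure.map_id]
  have hpushR : ((μA.map R).withDensity (expDensity φ)).map T
      = (μA.withDensity (expDensity (φ ∘ R))).map (T ∘ R) := by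
    rw [← map_withDensity_comp hRm (measurable_expDensity hφ), Measure.map_map hTm hRm]
    rfl
  refine ⟨fun hφR => ?_, fun hμR => ?_⟩
  · have hm : ((μA.map R).withDensity (expDensity φ)).map T = μA.map R := by
      rw [hpushR, ← hpush]
      congr 1
      refine withDensity_congr_ae ?_
      filter_upwards [hmemA] with x hx
      simp only [expDensity, Function.comp_apply]
      rw [hφR x hx, hrA x hx]
      rfl
    have hmprob : IsProbabilityMeasure (μA.map R) :=
      Measure.isProbabilityMeasure_map hRm.aemeasurable
    have hmμ : μA.map R = μ := by
      rcases hyp with huniq | ⟨⟨hac, -⟩, herg⟩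
      · exact huniq _ hmprob ((map_eq_withDensity_iff hTm hTim hTl hTr).2 hm)
      · refine eq_of_absolutelyContinuous_of_conformal hTm hTim hTl hφ hTμ hm ?_
          (preErgodic_of_symmDiff herg)
        have h1 := hac.map hRm
        rwa [Measure.map_map hRm hRim, (funext hRRi : R ∘ Rinv = id), Measure.map_id] at h1
    rw [← hmμ, hRback]
  · have hm : μA.map R = μ := by
      rw [hμR, Measure.map_map hRm hRim, (funext hRRi : R ∘ Rinv = id), Measure.map_id]
    have heq : (μA.withDensity (expDensity (φ ∘ R))).map (T ∘ R)
        = (μA.withDensity (expDensity fun x => birkhoffSum T φ (r x) x)).map (T ∘ R) := by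
      rw [← hpushR, hpush, hm, hTμ]
    have hinv : ∀ g : X → ℝ≥0∞,
        ((μA.withDensity g).map (T ∘ R)).map (Rinv ∘ Tinv) = μA.withDensity g := by
      intro g
      rw [Measure.map_map (hRim.comp hTim) (hTm.comp hRm)]
      have : (Rinv ∘ Tinv) ∘ (T ∘ R) =ᵐ[μA.withDensity g] id := by
        filter_upwards [(withDensity_absolutelyContinuous μA g).ae_le hmemA] with x hx
        simp only [Function.comp_apply, id_eq]
        rw [hTl, hRiR x hx]
      rw [Measure.map_congr this, Measure.map_id]
    have hdens := congrArg (Measure.map (Rinv ∘ Tinv)) heq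
    rw [hinv, hinv, withDensity_eq_iff_of_sigmaFinite
      (measurable_expDensity (hφ.comp hRm)).aemeasurable
      (measurable_expDensity hSm).aemeasurable] at hdens
    filter_upwards [hdens, hmemA] with x hx hxA
    have h1 : φ (R x) = birkhoffSum T φ (r x) x :=
      expDensity_inj (φ := φ ∘ R) hx
    rw [h1, hrA x hxA]
    rfl
end

section
/- Let G be a finite directed graph with vertex set Σ and edge set ℰ, and let ϑ : ℰ → ℝ_{≥0}. Assume that for every ordered pair of vertices (u, v) there exists a path of length 2 in G from u to v. For n ≥ 1 set ζ_n(ϑ) = (1/n)·max{ ϑ(ϱ) : ϱ a path in G of length n }, where ϑ is extended additively to paths. Then the limit ζ(ϑ) := lim_{n→∞} ζ_n(ϑ) exists and equals inf_{n≥1} ζ_n(ϑ), and moreover ζ(ϑ) = sup{ ϑ(C)/|C| : C a loop in G } = max{ ϑ(C)/|C| : C an elementary loop in G }, where |C| denotes the length of the loop C. -/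
open Filter

section Graph

variable {V : Type*} [Fintype V]

/-- `p : Fin (n+1) → V` is a path of length `n` in the directed graph with edge
relation `E`. -/
def IsGraphPath (E : V → V → Prop) (n : ℕ) (p : Fin (n + 1) → V) : Prop :=
  ∀ i : Fin n, E (p i.castSucc) (p i.succ)

/-- The additive weight of a path of length `n`. -/
def pathWeight (ϑ : V → V → ℝ) (n : ℕ) (p : Fin (n + 1) → V) : ℝ :=
  ∑ i : Fin n, ϑ (p i.castSucc) (p i.succ)

/-- A loop (cyclic path) of length `n ≥ 1`. -/
def IsGraphLoop (E : V → V → Prop) (n : ℕ) (p : Fin (n + 1) → V) : Prop :=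
  1 ≤ n ∧ IsGraphPath E n p ∧ p (Fin.last n) = p 0

/-- An elementary loop: a loop with no repeated vertices (apart from the endpoint). -/
def IsElementaryLoop (E : V → V → Prop) (n : ℕ) (p : Fin (n + 1) → V) : Prop :=
  IsGraphLoop E n p ∧ Function.Injective fun i : Fin n => p i.castSucc

end Graph

open Finset in
/-- A walk of which every elementary loop has nonpositive weight has weight bounded independently
of its length. -/
theorem sum_walk_le_card_mul {V : Type*} [Fintype V] (E : V → V → Prop) (w : V → V → ℝ) (B : ℝ)
    (hB0 : 0 ≤ B) (hB : ∀ u v, w u v ≤ B)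
    (hloop : ∀ (k : ℕ) (f : ℕ → V), 1 ≤ k → (∀ i < k, E (f i) (f (i + 1))) → f k = f 0 →
      Set.InjOn f (Set.Iio k) → ∑ i ∈ range k, w (f i) (f (i + 1)) ≤ 0)
    (n : ℕ) (f : ℕ → V) (hf : ∀ i < n, E (f i) (f (i + 1))) :
    ∑ i ∈ range n, w (f i) (f (i + 1)) ≤ Fintype.card V * B := by
  classical
  induction n using Nat.strong_induction_on generalizing f with
  | _ n ih =>
  by_cases hrep : ∃ j, j < n ∧ ∃ i < j, f i = f j
  · have hmin := fun m hm => Nat.find_min hrep (m := m) hm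
    obtain ⟨hjn, i, hij, hfij⟩ := Nat.find_spec hrep
    generalize Nat.find hrep = j at *
    obtain ⟨d, rfl⟩ := Nat.exists_eq_add_of_lt hij
    obtain ⟨r, rfl⟩ := Nat.exists_eq_add_of_lt hjn
    have hinj : Set.InjOn f (Set.Iio (i + d + 1)) := by
      intro a ha b hb hab
      simp only [Set.mem_Iio] at ha hb
      by_contra hne
      rcases lt_or_gt_of_ne hne with h | h
      · exact hmin b hb ⟨by omega, a, h, hab⟩
      · exact hmin a ha ⟨by omega, b, h, hab.symm⟩
    have h1 := hloop (d + 1) (fun m => f (i + m)) (by omega) (fun m hm => hf (i + m) (by omega))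
      hfij.symm (by
        intro a ha b hb hab
        simp only [Set.mem_Iio] at ha hb
        have := hinj (show i + a < i + d + 1 by omega)
          (show i + b < i + d + 1 by omega) hab
        omega)
    let q : ℕ → V := fun m => if m < i then f m else f (m + (d + 1))
    have hq1 : ∀ m ≤ i, q m = f m := by
      intro m hm
      rcases hm.lt_or_eq with h | rfl
      · simp [q, h]
      · simpa [q, add_assoc] using hfij.symm
    have hq2 : ∀ m, q (i + m) = f (i + (d + 1) + m) := by
      intro m
      simp only [q, show ¬ i + m < i by omega, if_false]
      congr 1
      omega
    have h2 := ih (i + (r + 1)) (by omega) q (by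
      intro m hm
      rcases lt_or_ge m i with h | h
      · rw [hq1 m h.le, hq1 (m + 1) h]
        exact hf m (by omega)
      · obtain ⟨t, rfl⟩ := Nat.exists_eq_add_of_le h
        rw [add_assoc, hq2, hq2]
        exact hf (i + (d + 1) + t) (by omega))
    rw [sum_range_add] at h2
    have e1 : ∑ m ∈ range i, w (q m) (q (m + 1)) = ∑ m ∈ range i, w (f m) (f (m + 1)) :=
      sum_congr rfl fun m hm => by
        have := mem_range.1 hm
        rw [hq1 m this.le, hq1 (m + 1) this]
    have e2 : ∑ m ∈ range (r + 1), w (q (i + m)) (q (i + m + 1)) =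
        ∑ m ∈ range (r + 1), w (f (i + (d + 1) + m)) (f (i + (d + 1) + m + 1)) :=
      sum_congr rfl fun m _ => by rw [add_assoc i m 1, hq2, hq2, ← add_assoc _ m 1]
    rw [show i + d + 1 + r + 1 = i + (d + 1) + (r + 1) by omega, sum_range_add, sum_range_add]
    simp only [← add_assoc] at *
    linarith
  · have hinj : Set.InjOn f (range n) := by
      intro a ha b hb hab
      simp only [coe_range, Set.mem_Iio] at ha hb
      by_contra hne
      rcases lt_or_gt_of_ne hne with h | h
      · exact hrep ⟨b, hb, a, h, hab⟩
      · exact hrep ⟨a, ha, b, h, hab.symm⟩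
    have hcard : n ≤ Fintype.card V := by
      rw [← card_range n, ← card_image_of_injOn hinj]
      exact card_le_univ _
    calc ∑ i ∈ range n, w (f i) (f (i + 1)) ≤ ∑ _i ∈ range n, B := sum_le_sum fun _ _ => hB _ _
      _ = n * B := by simp
      _ ≤ Fintype.card V * B := by gcongr

open Finset in
/-- Some window of length `n` of a `k`-periodic real sequence has at least the average sum. -/
theorem Function.Periodic.exists_mul_sum_range_le {g : ℕ → ℝ} {k : ℕ} (hg : Function.Periodic g k)
    (hk : 1 ≤ k) (n : ℕ) :
    ∃ s, n * ∑ i ∈ range k, g i ≤ k * ∑ i ∈ range n, g (s + i) := by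
  have hwin : ∀ i, ∑ s ∈ range k, g (s + i) = ∑ s ∈ range k, g s := by
    intro i
    induction i with
    | zero => simp
    | succ i ih =>
      rw [← ih]
      have h1 := sum_range_succ (fun s => g (s + i)) k
      have h2 := sum_range_succ' (fun s => g (s + i)) k
      have h3 : g (k + i) = g (0 + i) := by rw [add_comm, hg, zero_add]
      have h4 : ∀ s, s + 1 + i = s + (i + 1) := by intro s; omega
      simp only [h4] at h2
      linarith
  have hsum : ∑ s ∈ range k, ∑ i ∈ range n, g (s + i) = n * ∑ i ∈ range k, g i := by
    rw [sum_comm]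
    simp [hwin]
  obtain ⟨s, -, hs⟩ := exists_le_of_sum_le (s := range k) (f := fun _ => (n * ∑ i ∈ range k, g i) / k)
    (g := fun s => ∑ i ∈ range n, g (s + i)) ⟨0, mem_range.2 hk⟩ (by
      have : (k : ℝ) ≠ 0 := by positivity
      rw [hsum, sum_const, card_range, nsmul_eq_mul, mul_div_cancel₀ _ this])
  refine ⟨s, ?_⟩
  have : (0 : ℝ) < k := by positivity
  rwa [div_le_iff₀' this] at hs

section Graph

variable {V : Type*}

theorem isGraphPath_coe_iff {E : V → V → Prop} {n : ℕ} {f : ℕ → V} :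
    IsGraphPath E n (fun i => f i) ↔ ∀ i < n, E (f i) (f (i + 1)) := by
  simp [IsGraphPath, Fin.forall_iff]

theorem pathWeight_coe (ϑ : V → V → ℝ) (n : ℕ) (f : ℕ → V) :
    pathWeight ϑ n (fun i => f i) = ∑ i ∈ Finset.range n, ϑ (f i) (f (i + 1)) := by
  simp [pathWeight, Finset.sum_range]

theorem exists_eq_nat_walk {n : ℕ} (p : Fin (n + 1) → V) : ∃ f : ℕ → V, p = fun i : Fin (n + 1) => f i :=
  ⟨fun i => p ⟨min i n, by omega⟩, by
    funext i
    congr 1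
    ext
    simp only
    omega⟩

theorem IsGraphLoop.exists_path_mul_le {E : V → V → Prop} {k : ℕ} {p : Fin (k + 1) → V}
    (hp : IsGraphLoop E k p) (ϑ : V → V → ℝ) (n : ℕ) :
    ∃ q : Fin (n + 1) → V, IsGraphPath E n q ∧ n * pathWeight ϑ k p ≤ k * pathWeight ϑ n q := by
  obtain ⟨hk, hE, hlast⟩ := hp
  let f : ℕ → V := fun i => p ⟨i % k, (Nat.mod_lt i hk).trans (Nat.lt_succ_self k)⟩
  have hstep : ∀ i, f (i + 1) = p (Fin.succ ⟨i % k, Nat.mod_lt i hk⟩) := by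
    intro i
    have hlt := Nat.mod_lt i hk
    rcases Nat.lt_or_ge (i % k + 1) k with h | h
    · have : (i + 1) % k = i % k + 1 := by
        rw [Nat.add_mod, ← Nat.mod_eq_of_lt h]
        simp
      simp [f, this]
    · have h' : i % k + 1 = k := by omega
      have : (i + 1) % k = 0 := by
        rw [← Nat.mod_add_mod, h', Nat.mod_self]
      have e : Fin.succ ⟨i % k, Nat.mod_lt i hk⟩ = Fin.last k := by ext; simpa using h'
      rw [e, hlast]
      simp only [f, this]
      rfl
  have hper : Function.Periodic (fun i => ϑ (f i) (f (i + 1))) k := by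
    intro i
    simp [f, show i + k + 1 = i + 1 + k by omega]
  have hw : ∑ i ∈ Finset.range k, ϑ (f i) (f (i + 1)) = pathWeight ϑ k p := by
    rw [Finset.sum_range, pathWeight]
    refine Finset.sum_congr rfl fun i _ => ?_
    rw [hstep]
    simp only [f, Nat.mod_eq_of_lt i.isLt]
    rfl
  obtain ⟨s, hs⟩ := hper.exists_mul_sum_range_le hk n
  refine ⟨fun i => f (s + i), isGraphPath_coe_iff (f := fun m => f (s + m)).2 fun i _ => ?_, ?_⟩
  · rw [← add_assoc, hstep]
    exact hE ⟨(s + i) % k, Nat.mod_lt _ hk⟩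
  · rw [pathWeight_coe ϑ n fun m => f (s + m), ← hw]
    exact hs

theorem isElementaryLoop_coe {E : V → V → Prop} {k : ℕ} {f : ℕ → V} (hk : 1 ≤ k)
    (hE : ∀ i < k, E (f i) (f (i + 1))) (hlast : f k = f 0) (hinj : Set.InjOn f (Set.Iio k)) :
    IsElementaryLoop E k (fun i => f i) :=
  ⟨⟨hk, isGraphPath_coe_iff.2 hE, by simpa using hlast⟩,
    fun a b hab => Fin.ext (hinj a.isLt b.isLt hab)⟩

theorem exists_isElementaryLoop [Nonempty V] {E : V → V → Prop}
    (hconn : ∀ u v : V, ∃ w : V, E u w ∧ E w v) :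
    ∃ (n : ℕ) (p : Fin (n + 1) → V), IsElementaryLoop E n p := by
  obtain ⟨u⟩ := ‹Nonempty V›
  obtain ⟨v, huv, hvu⟩ := hconn u u
  by_cases h : v = u
  · subst h
    exact ⟨1, _, isElementaryLoop_coe (f := fun _ => v) le_rfl (fun _ _ => huv) rfl
      fun a ha b hb _ => by simp only [Set.mem_Iio] at ha hb; omega⟩
  · refine ⟨2, _, isElementaryLoop_coe (f := fun i => if i = 1 then v else u) (by omega) ?_
      (by simp) ?_⟩
    · intro i hi
      interval_cases i <;> simpa
    · intro a ha b hb hab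
      simp only [Set.mem_Iio] at ha hb
      interval_cases a <;> interval_cases b <;> simp_all

theorem finite_elementaryLoop_means [Fintype V] (E : V → V → Prop) (ϑ : V → V → ℝ) :
    {x : ℝ | ∃ (n : ℕ) (p : Fin (n + 1) → V),
      IsElementaryLoop E n p ∧ x = pathWeight ϑ n p / n}.Finite := by
  refine ((Set.finite_Iic (Fintype.card V)).biUnion fun n _ =>
    Set.finite_range fun p : Fin (n + 1) → V => pathWeight ϑ n p / n).subset ?_
  rintro x ⟨n, p, hp, rfl⟩
  have := Fintype.card_le_of_injective _ hp.2
  rw [Fintype.card_fin] at this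
  exact Set.mem_biUnion (Set.mem_Iic.2 this) ⟨p, rfl⟩

/-- If every elementary loop has mean weight at most `M`, then the weight of a path of length `n`
exceeds `n * M` by at most a constant. -/
theorem exists_pathWeight_le [Fintype V] {E : V → V → Prop} {ϑ : V → V → ℝ} {M : ℝ}
    (hM : ∀ (n : ℕ) (p : Fin (n + 1) → V), IsElementaryLoop E n p → pathWeight ϑ n p ≤ n * M) :
    ∃ C : ℝ, ∀ (n : ℕ) (p : Fin (n + 1) → V), IsGraphPath E n p →
      pathWeight ϑ n p ≤ n * M + C := by
  obtain ⟨B, hB⟩ := (Set.finite_range fun e : V × V => ϑ e.1 e.2 - M).bddAbove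
  refine ⟨Fintype.card V * max B 0, fun n p hp => ?_⟩
  obtain ⟨f, rfl⟩ := exists_eq_nat_walk p
  have := sum_walk_le_card_mul E (fun u v => ϑ u v - M) (max B 0) (le_max_right _ _)
    (fun u v => (hB ⟨(u, v), rfl⟩).trans (le_max_left _ _))
    (fun k f hk hE hlast hinj => by
      have := hM k _ (isElementaryLoop_coe hk hE hlast hinj)
      rw [pathWeight_coe] at this
      simpa using this) n f (isGraphPath_coe_iff.1 hp)
  rw [pathWeight_coe]
  simp only [Finset.sum_sub_distrib, Finset.sum_const, Finset.card_range, nsmul_eq_mul] at this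
  linarith

end Graph

/-- For a finite directed graph in which any ordered pair of vertices is joined by a
path of length 2, and a nonnegative weight `ϑ` on edges, the maximal mean weights
`ζ_n = (1/n)·max{ϑ(ϱ) : ϱ path of length n}` converge to `inf_{n ≥ 1} ζ_n`, and this
limit equals the supremum of the mean weights of loops, which is attained (as a
maximum) on an elementary loop. -/
theorem zeta_limit_eq_max_elementary_loops
    {V : Type*} [Fintype V] [Nonempty V]
    (E : V → V → Prop) (ϑ : V → V → ℝ)
    (hϑ : ∀ u v, E u v → 0 ≤ ϑ u v)
    (hconn : ∀ u v : V, ∃ w : V, E u w ∧ E w v)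
    (ζ : ℕ → ℝ)
    (hζ : ∀ n : ℕ, ζ n =
      (sSup {x : ℝ | ∃ p : Fin (n + 1) → V, IsGraphPath E n p ∧ x = pathWeight ϑ n p}) / n) :
    Tendsto ζ atTop (nhds (sInf {x : ℝ | ∃ n : ℕ, 1 ≤ n ∧ x = ζ n})) ∧
    sInf {x : ℝ | ∃ n : ℕ, 1 ≤ n ∧ x = ζ n}
      = sSup {x : ℝ | ∃ (n : ℕ) (p : Fin (n + 1) → V),
          IsGraphLoop E n p ∧ x = pathWeight ϑ n p / n} ∧
    sInf {x : ℝ | ∃ n : ℕ, 1 ≤ n ∧ x = ζ n}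
      = sSup {x : ℝ | ∃ (n : ℕ) (p : Fin (n + 1) → V),
          IsElementaryLoop E n p ∧ x = pathWeight ϑ n p / n} ∧
    (∃ (n : ℕ) (p : Fin (n + 1) → V), IsElementaryLoop E n p ∧
      pathWeight ϑ n p / n = sInf {x : ℝ | ∃ n : ℕ, 1 ≤ n ∧ x = ζ n}) := by
  have hfin := finite_elementaryLoop_means E ϑ
  set S : Set ℝ := {x : ℝ | ∃ (n : ℕ) (p : Fin (n + 1) → V),
      IsElementaryLoop E n p ∧ x = pathWeight ϑ n p / n}
  obtain ⟨n₁, p₁, hp₁⟩ := exists_isElementaryLoop hconn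
  have hne : S.Nonempty := ⟨_, n₁, p₁, hp₁, rfl⟩
  obtain ⟨k, p, hp, hpM⟩ := hne.csSup_mem hfin
  set M := sSup S
  have hM : ∀ (n : ℕ) (q : Fin (n + 1) → V), IsElementaryLoop E n q →
      pathWeight ϑ n q ≤ n * M := by
    intro n q hq
    have hn : (0 : ℝ) < n := by exact_mod_cast hq.1.1
    rw [← div_le_iff₀' hn]
    exact le_csSup hfin.bddAbove ⟨n, q, hq, rfl⟩
  obtain ⟨C, hC⟩ := exists_pathWeight_le hM
  have hpath : ∀ (n : ℕ) (q : Fin (n + 1) → V), 1 ≤ n → IsGraphPath E n q →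
      pathWeight ϑ n q ≤ n * ζ n := by
    intro n q hn hq
    have hn : (0 : ℝ) < n := by exact_mod_cast hn
    rw [hζ, mul_div_cancel₀ _ hn.ne']
    refine le_csSup ?_ ⟨q, hq, rfl⟩
    refine ((Set.finite_range (pathWeight ϑ n)).subset ?_).bddAbove
    rintro _ ⟨r, -, rfl⟩
    exact ⟨r, rfl⟩
  have hlower : ∀ (m : ℕ) (q : Fin (m + 1) → V), IsGraphLoop E m q → ∀ n, 1 ≤ n →
      pathWeight ϑ m q / m ≤ ζ n := by
    intro m q hq n hn
    obtain ⟨r, hr, hle⟩ := hq.exists_path_mul_le ϑ n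
    have hm : (0 : ℝ) < m := by exact_mod_cast hq.1
    have hn' : (0 : ℝ) < n := by exact_mod_cast hn
    rw [div_le_iff₀' hm]
    have := mul_le_mul_of_nonneg_left (hpath n r hn hr) hm.le
    nlinarith
  have hMζ : ∀ n, 1 ≤ n → M ≤ ζ n := fun n hn => hpM ▸ hlower k p hp.1 n hn
  have hupper : ∀ n, 1 ≤ n → ζ n ≤ M + C / n := by
    intro n hn
    obtain ⟨r, hr, -⟩ := hp.1.exists_path_mul_le ϑ n
    have hn' : (0 : ℝ) < n := by exact_mod_cast hn
    rw [hζ, div_le_iff₀ hn', add_mul, div_mul_cancel₀ _ hn'.ne', mul_comm M]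
    refine csSup_le ⟨_, r, hr, rfl⟩ ?_
    rintro _ ⟨q, hq, rfl⟩
    exact hC n q hq
  have hlim : Tendsto ζ atTop (nhds M) := by
    refine tendsto_of_tendsto_of_tendsto_of_le_of_le' tendsto_const_nhds
      (h := fun n : ℕ => M + C / n) ?_ ?_ ?_
    · simpa using (tendsto_const_div_atTop_nhds_zero_nat C).const_add M
    · exact (eventually_ge_atTop 1).mono hMζ
    · exact (eventually_ge_atTop 1).mono hupper
  have hinf : sInf {x : ℝ | ∃ n : ℕ, 1 ≤ n ∧ x = ζ n} = M := by
    apply le_antisymm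
    · refine ge_of_tendsto hlim ((eventually_ge_atTop 1).mono fun n hn => ?_)
      refine csInf_le ⟨M, ?_⟩ ⟨n, hn, rfl⟩
      rintro _ ⟨m, hm, rfl⟩
      exact hMζ m hm
    · refine le_csInf ⟨_, 1, le_rfl, rfl⟩ ?_
      rintro _ ⟨m, hm, rfl⟩
      exact hMζ m hm
  rw [hinf]
  refine ⟨hlim, ?_, rfl, k, p, hp, hpM.symm⟩
  have hgreatest : IsGreatest {x : ℝ | ∃ (n : ℕ) (p : Fin (n + 1) → V),
      IsGraphLoop E n p ∧ x = pathWeight ϑ n p / n} M := by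
    refine ⟨⟨k, p, hp.1, hpM⟩, ?_⟩
    rintro _ ⟨m, q, hq, rfl⟩
    exact ge_of_tendsto hlim ((eventually_ge_atTop 1).mono (hlower m q hq))
  exact hgreatest.csSup_eq.symm
end
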